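/- Let k be a field of characteristic ≠ 2, 3. Then there are no simple (finite-dimensional) null symplectic triple systems over k. -/

import Mathlib

/-- A null symplectic triple system: a trilinear product which is symmetric in its
arguments and such that the maps `d_{x,y} = [xy·]` are derivations of the product. -/
def IsNullSTS (k : Type*) {T : Type*} [Field k] [AddCommGroup T] [Module k T]
    (tp : T →ₗ[k] T →ₗ[k] T →ₗ[k] T) : Prop :=
  (∀ x y z : T, tp x y z = tp y x z) ∧
  (∀ x y z : T, tp x y z = tp x z y) ∧
  (∀ x y u v w : T, tp x y (tp u v w) =
      tp (tp x y u) v w + tp u (tp x y v) w + tp u v (tp x y w))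

/-- An ideal of a null symplectic triple system: a subspace `I` with `[TTI] ⊆ I`. -/
def IsIdealNullSTS (k : Type*) {T : Type*} [Field k] [AddCommGroup T] [Module k T]
    (tp : T →ₗ[k] T →ₗ[k] T →ₗ[k] T) (I : Submodule k T) : Prop :=
  ∀ x y z : T, z ∈ I → tp x y z ∈ I

/-- A null symplectic triple system is simple if `[TTT] ≠ 0` and it has no proper
nonzero ideal. -/
def IsSimpleNullSTS (k : Type*) {T : Type*} [Field k] [AddCommGroup T] [Module k T]
    (tp : T →ₗ[k] T →ₗ[k] T →ₗ[k] T) : Prop :=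
  (∃ x y z : T, tp x y z ≠ 0) ∧
  ∀ I : Submodule k T, IsIdealNullSTS k tp I → I = ⊥ ∨ I = ⊤

attribute [local instance] LieRing.ofAssociativeRing

/-- Maximality step in Jacobson's theorem on weakly closed sets: a Lie algebra of nilpotent
endomorphisms spanned by elements of the bracket-closed set `S`, but not containing all of `S`,
is strictly contained in another one. -/
theorem exists_lt_lieSubalgebra_of_forall_isNilpotent {k V : Type*} [Field k] [AddCommGroup V]
    [Module k V] [FiniteDimensional k V] {S : Set (Module.End k V)}
    (hS : ∀ x ∈ S, ∀ y ∈ S, ⁅x, y⁆ ∈ S) (hnil : ∀ x ∈ S, IsNilpotent x)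
    {U : LieSubalgebra k (Module.End k V)}
    (hUS : U.toSubmodule ≤ Submodule.span k (S ∩ U))
    (hU : ∀ u ∈ U, IsNilpotent u) (hne : ¬ S ⊆ U) :
    ∃ U' : LieSubalgebra k (Module.End k V), U < U' ∧
      U'.toSubmodule ≤ Submodule.span k (S ∩ U') ∧ ∀ u ∈ U', IsNilpotent u := by
  obtain ⟨x, hxS, hxU, hxN⟩ : ∃ x ∈ S, x ∉ U ∧ x ∈ U.normalizer := by
    have hnilp : LieModule.IsNilpotent U (Module.End k V) := by
      rw [LieModule.isNilpotent_iff_forall (R := k)]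
      intro u
      exact LieAlgebra.ad_nilpotent_of_nilpotent (hU u u.2)
    obtain ⟨n, hn⟩ := LieModule.IsNilpotent.nilpotent k U (Module.End k V)
    have hex : ∃ m, ∀ y ∈ S, y ∈ LieModule.lowerCentralSeries k U (Module.End k V) m → y ∈ U :=
      ⟨n, fun y _ hy => by
        rw [hn, LieSubmodule.mem_bot] at hy
        exact hy ▸ U.zero_mem⟩
    classical
    have hspec := Nat.find_spec hex
    obtain ⟨m, hm⟩ : ∃ m, Nat.find hex = m + 1 := by
      refine Nat.exists_eq_succ_of_ne_zero fun h0 => hne fun y hy => ?_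
      rw [h0] at hspec
      exact hspec y hy (by simp)
    have hmin := Nat.find_min hex (m := m) (by omega)
    rw [hm] at hspec
    push Not at hmin
    obtain ⟨x, hxS, hxm, hxU⟩ := hmin
    refine ⟨x, hxS, hxU, ?_⟩
    rw [LieSubalgebra.mem_normalizer_iff']
    intro y hy
    have hy' := hUS hy
    clear hy
    induction hy' using Submodule.span_induction with
    | mem u hu =>
      refine hspec _ (hS u hu.1 x hxS) ?_
      rw [LieModule.lowerCentralSeries_succ]
      exact LieSubmodule.lie_mem_lie (x := (⟨u, hu.2⟩ : U)) (LieSubmodule.mem_top _) hxm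
    | zero => simp
    | add a b _ _ ha hb => rw [add_lie]; exact U.add_mem ha hb
    | smul c a _ ha => rw [smul_lie]; exact U.smul_mem c ha
  let K' : LieSubalgebra k (Module.End k V) :=
    { (k ∙ x) ⊔ (U : Submodule k (Module.End k V)) with
      lie_mem' := fun {y z} => LieSubalgebra.lie_mem_sup_of_mem_normalizer hxN }
  have hxK' : x ∈ K' := Submodule.mem_sup_left (Submodule.mem_span_singleton_self x)
  have hUK' : U ≤ K' := (LieSubalgebra.toSubmodule_le_toSubmodule U K').mp le_sup_right
  have hK' : K' ≤ U.normalizer := by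
    rw [← LieSubalgebra.toSubmodule_le_toSubmodule]
    exact sup_le ((Submodule.span_singleton_le_iff_mem _ _).mpr hxN) U.le_normalizer
  refine ⟨K', lt_iff_le_and_ne.mpr ⟨hUK', fun h => hxU (h.symm ▸ hxK')⟩, ?_, ?_⟩
  · refine sup_le ?_ (hUS.trans (Submodule.span_mono fun y hy => ⟨hy.1, hUK' hy.2⟩))
    rw [Submodule.span_singleton_le_iff_mem]
    exact Submodule.subset_span ⟨hxS, hxK'⟩
  · obtain ⟨I, hI₁ : (I : LieSubalgebra k K') = LieSubalgebra.ofLe hUK'⟩ :=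
      LieSubalgebra.exists_nested_lieIdeal_ofLe_normalizer hUK' hK'
    have hI₂ : k ∙ (⟨x, hxK'⟩ : K') ⊔ LieSubmodule.toSubmodule I = ⊤ := by
      rw [← LieIdeal.toLieSubalgebra_toSubmodule k K' I, hI₁]
      apply Submodule.map_injective_of_injective
        (K' : Submodule k (Module.End k V)).injective_subtype
      simp only [LieSubalgebra.coe_ofLe, Submodule.map_sup, Submodule.map_subtype_range_inclusion,
        Submodule.map_top, Submodule.range_subtype]
      rw [Submodule.map_subtype_span_singleton]
    have hI₃ : LieModule.IsNilpotent I V := by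
      rw [LieModule.isNilpotent_iff_forall (R := k)]
      rintro ⟨y, hy⟩
      have hy' : y ∈ LieSubalgebra.ofLe hUK' := hI₁ ▸ hy
      rw [LieSubalgebra.mem_ofLe] at hy'
      exact hU _ hy'
    have hK'nil : LieModule.IsNilpotent K' V :=
      LieSubmodule.isNilpotentOfIsNilpotentSpanSupEqTop hI₂ (hnil x hxS) hI₃
    intro u hu
    exact LieModule.isNilpotent_toEnd_of_isNilpotent k K' V ⟨u, hu⟩

/-- Jacobson's theorem: a bracket-closed set of nilpotent endomorphisms of a nonzero
finite-dimensional space has a common nonzero kernel vector. -/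
theorem exists_ne_zero_forall_apply_eq_zero {k V : Type*} [Field k] [AddCommGroup V]
    [Module k V] [FiniteDimensional k V] [Nontrivial V] {S : Set (Module.End k V)}
    (hS : ∀ x ∈ S, ∀ y ∈ S, ⁅x, y⁆ ∈ S) (hnil : ∀ x ∈ S, IsNilpotent x) :
    ∃ v : V, v ≠ 0 ∧ ∀ x ∈ S, x v = 0 := by
  let s := {U : LieSubalgebra k (Module.End k V) |
    U.toSubmodule ≤ Submodule.span k (S ∩ U) ∧ ∀ u ∈ U, IsNilpotent u}
  have hs : s.Nonempty := ⟨⊥, by simp, by simp⟩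
  obtain ⟨U, ⟨hUS, hU⟩, hmax⟩ :=
    (LieSubalgebra.wellFoundedGT_of_noetherian k (Module.End k V)).wf.has_min s hs
  have hSU : S ⊆ U := by
    by_contra hne
    obtain ⟨U', hlt, hU'⟩ := exists_lt_lieSubalgebra_of_forall_isNilpotent hS hnil hUS hU hne
    exact hmax U' hU' hlt
  have hUnil : LieModule.IsNilpotent U V := by
    rw [LieModule.isNilpotent_iff_forall (R := k)]
    exact fun u => hU u u.2
  have := LieModule.nontrivial_max_triv_of_isNilpotent k U V
  obtain ⟨v, hv⟩ := exists_ne (0 : LieModule.maxTrivSubmodule k U V)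
  refine ⟨v, by simpa using hv, fun x hx => ?_⟩
  exact (LieModule.mem_maxTrivSubmodule k U V (v : V)).mp v.2 ⟨x, hSU hx⟩

namespace IsNullSTS

variable {k T : Type*} [Field k] [AddCommGroup T] [Module k T]
  {tp : T →ₗ[k] T →ₗ[k] T →ₗ[k] T}

/-- The derivations `d_{x,y}` as elements of the endomorphism algebra. -/
def der (tp : T →ₗ[k] T →ₗ[k] T →ₗ[k] T) (x y : T) : Module.End k T := tp x y

theorem der_comm (h : IsNullSTS k tp) (x y : T) : der tp x y = der tp y x :=
  LinearMap.ext fun z => h.1 x y z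

theorem lie_der (h : IsNullSTS k tp) (a b c d : T) :
    ⁅der tp a b, der tp c d⁆ = der tp (tp a b c) d + der tp c (tp a b d) := by
  ext e
  simp [Ring.lie_def, der, h.2.2 a b c d e]

theorem der_tp (h : IsNullSTS k tp) (a b c d : T) :
    der tp (tp a b c) d = der tp a b * der tp c d + der tp a c * der tp b d +
      der tp b c * der tp a d := by
  ext e
  obtain ⟨h1, h2, h3⟩ := h
  have key := h3 d e a b c
  simp only [der, Module.End.mul_apply, LinearMap.add_apply]
  simp only [h1, h2] at key ⊢
  rw [key]
  abel

theorem der_tp' (h : IsNullSTS k tp) (hk : (3 : k) ≠ 0) (a b c d : T) :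
    der tp (tp a b c) d = -(der tp c d * der tp a b + der tp b d * der tp a c +
      der tp a d * der tp b c) := by
  ext e
  obtain ⟨h1, h2, h3⟩ := h
  have e1 := h3 a b c d e
  have e2 := h3 a c b d e
  have e3 := h3 a e b c d
  have e4 := h3 b c a d e
  have e5 := h3 b e a c d
  have e6 := h3 c e a b d
  refine smul_right_injective T hk ?_
  simp only [der, Module.End.mul_apply, LinearMap.add_apply, LinearMap.neg_apply]
  simp only [h1, h2] at e1 e2 e3 e4 e5 e6 ⊢
  linear_combination (norm := module) (-1 : k) • (e1 + e2 + e3 + e4 + e5 + e6)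

theorem der_mul_der_of_der_self_eq_zero (h : IsNullSTS k tp) (hk : (2 : k) ≠ 0) {z : T}
    (hz : der tp z z = 0) (a b : T) : der tp z a * der tp z b = 0 := by
  have h0 : tp z z a = 0 := LinearMap.congr_fun hz a
  have key := h.der_tp z z a b
  rw [h0, hz, zero_mul, zero_add] at key
  refine (smul_right_injective (Module.End k T) hk) ?_
  simp only [smul_zero, two_smul]
  rw [← key]
  simp [der]

/-- The elements with `d_{z,z} = 0` are stable under the operators `d_{b,b}`. -/
theorem der_tp_tp_self (h : IsNullSTS k tp) (h2 : (2 : k) ≠ 0) (h3 : (3 : k) ≠ 0) {z : T}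
    (hz : der tp z z = 0) (b : T) : der tp (tp b b z) (tp b b z) = 0 := by
  have hmul := h.der_mul_der_of_der_self_eq_zero h2 hz
  have hzw : der tp z (tp b b z) = 0 := by
    rw [h.der_comm, h.der_tp, hz, h.der_comm b z, hmul]
    simp
  have hbw : der tp z b * der tp b (tp b b z) = 0 := by
    have e1 := h.der_tp b b z b
    have e2 := h.der_tp' h3 b b z b
    rw [h.der_comm (tp b b z), h.der_comm b z] at e1 e2
    have f1 := congrArg (der tp z b * ·) e1
    have f2 := congrArg (der tp z b * ·) e2
    simp only [mul_add, mul_neg, ← mul_assoc, hmul, zero_mul, zero_add, add_zero] at f1 f2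
    refine (smul_right_injective (Module.End k T) h3) ?_
    linear_combination (norm := module) (2 : k) • f1 + f2
  rw [h.der_tp, hzw, h.der_comm b z, hbw]
  simp

/-- If `d_{z,z} = d_{a,a} = 0`, then `d_{z,a}` is a sandwich element. -/
theorem der_mul_der_mul_der (h : IsNullSTS k tp) (h2 : (2 : k) ≠ 0) (h3 : (3 : k) ≠ 0) {z a : T}
    (hz : der tp z z = 0) (ha : der tp a a = 0) (b c : T) :
    der tp z a * der tp b c * der tp z a = 0 := by
  have hmz := h.der_mul_der_of_der_self_eq_zero h2 hz
  have hma : ∀ c, der tp z a * der tp a c = 0 := fun c => by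
    rw [h.der_comm z a]; exact h.der_mul_der_of_der_self_eq_zero h2 ha z c
  have f1 := congrArg (der tp z a * ·) (h.der_tp z a b c)
  have f2 := congrArg (der tp z a * ·) (h.der_tp' h3 z a b c)
  simp only [mul_add, mul_neg, ← mul_assoc, hmz, hma, zero_mul, add_zero] at f1 f2
  rw [f1] at f2
  simpa using f2.symm

theorem der_cube_self (h : IsNullSTS k tp) (h2 : (2 : k) ≠ 0) (x : T) :
    der tp (tp x x x) (tp x x x) = 0 := by
  have key : der tp (tp x x x) x = 0 := by
    have := h.lie_der x x x x
    rw [lie_self, h.der_comm x (tp x x x), ← two_smul k] at this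
    exact (smul_eq_zero.mp this.symm).resolve_left h2
  rw [h.der_tp, h.der_comm x (tp x x x), key]
  simp

/-- Polarization: a symmetric trilinear product with vanishing cubes is zero. -/
theorem tp_eq_zero_of_cube (h : IsNullSTS k tp) (hk2 : (2 : k) ≠ 0) (hk3 : (3 : k) ≠ 0)
    (hc : ∀ x, tp x x x = 0) (x y z : T) : tp x y z = 0 := by
  obtain ⟨h1, h2, -⟩ := h
  have e1 := hc (x + y + z)
  have e2 := hc (x + y)
  have e3 := hc (x + z)
  have e4 := hc (y + z)
  have e5 := hc x
  have e6 := hc y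
  have e7 := hc z
  have h6 : (6 : k) ≠ 0 := by
    have : (6 : k) = 2 * 3 := by norm_num
    rw [this]; exact mul_ne_zero hk2 hk3
  refine (smul_right_injective T h6) ?_
  simp only [map_add, LinearMap.add_apply, h1, h2] at *
  linear_combination (norm := module) e1 - e2 - e3 - e4 + e5 + e6 + e7

/-- The span of all the derivations `d_{x,y}`. -/
def derSpan (tp : T →ₗ[k] T →ₗ[k] T →ₗ[k] T) : Submodule k (Module.End k T) :=
  Submodule.span k (Set.range fun p : T × T => der tp p.1 p.2)

theorem der_mem_derSpan (x y : T) : der tp x y ∈ derSpan tp :=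
  Submodule.subset_span ⟨(x, y), rfl⟩

theorem lie_mem_derSpan (h : IsNullSTS k tp) {X Y : Module.End k T} (hX : X ∈ derSpan tp)
    (hY : Y ∈ derSpan tp) : ⁅X, Y⁆ ∈ derSpan tp := by
  induction hX using Submodule.span_induction with
  | mem _ hx =>
    obtain ⟨p, rfl⟩ := hx
    induction hY using Submodule.span_induction with
    | mem _ hy =>
      obtain ⟨q, rfl⟩ := hy
      rw [h.lie_der]
      exact add_mem (der_mem_derSpan _ _) (der_mem_derSpan _ _)
    | zero => simp
    | add _ _ _ _ ha hb => rw [lie_add]; exact add_mem ha hb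
    | smul c _ _ ha => rw [lie_smul]; exact Submodule.smul_mem _ c ha
  | zero => simp
  | add _ _ _ _ ha hb => rw [add_lie]; exact add_mem ha hb
  | smul c _ _ ha => rw [smul_lie]; exact Submodule.smul_mem _ c ha

/-- The sandwich elements `N` of the derivation algebra: `N X N = 0` for every `X` in it. -/
def sandwich (tp : T →ₗ[k] T →ₗ[k] T →ₗ[k] T) : Set (Module.End k T) :=
  {N | N ∈ derSpan tp ∧ ∀ X ∈ derSpan tp, N * X * N = 0}

theorem isNilpotent_of_mem_sandwich {N : Module.End k T} (hN : N ∈ sandwich tp) :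
    IsNilpotent N :=
  ⟨3, by rw [pow_succ, pow_two]; exact hN.2 N hN.1⟩

theorem lie_mem_sandwich (h : IsNullSTS k tp) {N M : Module.End k T} (hN : N ∈ sandwich tp)
    (hM : M ∈ sandwich tp) : ⁅N, M⁆ ∈ sandwich tp := by
  refine ⟨h.lie_mem_derSpan hN.1 hM.1, fun X hX => ?_⟩
  have e1 : N * M * N = 0 := hN.2 M hM.1
  have e2 : M * N * M = 0 := hM.2 N hN.1
  have e3 := hN.2 X hX
  have e4 := hM.2 X hX
  have e5 : N * ⁅M, X⁆ * N = 0 := hN.2 _ (h.lie_mem_derSpan hM.1 hX)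
  have e6 : M * ⁅N, X⁆ * M = 0 := hM.2 _ (h.lie_mem_derSpan hN.1 hX)
  rw [Ring.lie_def] at e5 e6 ⊢
  have f5 : N * M * X * N = N * X * M * N := by
    rw [← sub_eq_zero, ← e5]; noncomm_ring
  have f6 : M * N * X * M = M * X * N * M := by
    rw [← sub_eq_zero, ← e6]; noncomm_ring
  calc (N * M - M * N) * X * (N * M - M * N)
      = N * M * X * N * M - N * (M * X * M) * N - M * (N * X * N) * M + M * N * X * M * N := by
        noncomm_ring
    _ = N * X * (M * N * M) + M * X * (N * M * N) := by
        rw [f5, f6, e3, e4]; noncomm_ring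
    _ = 0 := by rw [e1, e2]; simp

/-- In a simple system the elements with `d_{z,z} = 0` span. -/
theorem span_der_self_eq_zero_eq_top (h : IsNullSTS k tp) (h2 : (2 : k) ≠ 0) (h3 : (3 : k) ≠ 0)
    (hs : IsSimpleNullSTS k tp) : Submodule.span k {z : T | der tp z z = 0} = ⊤ := by
  obtain ⟨⟨x, y, z, hxyz⟩, hI⟩ := hs
  refine (hI _ ?_).resolve_left fun hbot => hxyz ?_
  · have hsq : ∀ b w, w ∈ Submodule.span k {z : T | der tp z z = 0} →
        tp b b w ∈ Submodule.span k {z : T | der tp z z = 0} := fun b w hw => by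
      induction hw using Submodule.span_induction with
      | mem w hw => exact Submodule.subset_span (h.der_tp_tp_self h2 h3 hw b)
      | zero => simp
      | add _ _ _ _ ha hb => rw [map_add]; exact add_mem ha hb
      | smul c _ _ ha => rw [map_smul]; exact Submodule.smul_mem _ c ha
    intro a b w hw
    rw [← Submodule.smul_mem_iff _ h2]
    have : (2 : k) • tp a b w = tp (a + b) (a + b) w - tp a a w - tp b b w := by
      simp only [map_add, LinearMap.add_apply, h.1 b a w]
      module
    rw [this]
    exact sub_mem (sub_mem (hsq _ _ hw) (hsq _ _ hw)) (hsq _ _ hw)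
  · refine h.tp_eq_zero_of_cube h2 h3 (fun x => ?_) x y z
    have : tp x x x ∈ Submodule.span k {z : T | der tp z z = 0} :=
      Submodule.subset_span (h.der_cube_self h2 x)
    rwa [hbot, Submodule.mem_bot] at this

end IsNullSTS

/-- Over a field of characteristic `≠ 2, 3` there are no simple
finite-dimensional null symplectic triple systems. -/
theorem no_simple_nullSTS (k : Type*) [Field k]
    (hchar2 : ringChar k ≠ 2) (hchar3 : ringChar k ≠ 3) :
    ∀ (T : Type*) (_ : AddCommGroup T) (_ : Module k T) (_ : FiniteDimensional k T)
      (tp : T →ₗ[k] T →ₗ[k] T →ₗ[k] T),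
      IsNullSTS k tp → ¬ IsSimpleNullSTS k tp := by
  intro T _ _ _ tp h hs
  have h2 : (2 : k) ≠ 0 := Ring.two_ne_zero hchar2
  have h3 : (3 : k) ≠ 0 := fun h0 => by
    have hdvd : ringChar k ∣ 3 := (ringChar.spec k 3).mp (by exact_mod_cast h0)
    rcases (Nat.dvd_prime Nat.prime_three).mp hdvd with h1 | h1
    · have : ((1 : ℕ) : k) = 0 := (ringChar.spec k 1).mpr h1.dvd
      simp at this
    · exact hchar3 h1
  have hspan := h.span_der_self_eq_zero_eq_top h2 h3 hs
  obtain ⟨⟨x, y, z, hxyz⟩, hI⟩ := hs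
  have : Nontrivial T := ⟨_, _, hxyz⟩
  obtain ⟨v, hv0, hv⟩ := exists_ne_zero_forall_apply_eq_zero
    (fun _ hN _ hM => h.lie_mem_sandwich hN hM)
    (fun _ hN => IsNullSTS.isNilpotent_of_mem_sandwich (tp := tp) hN)
  have hsand : ∀ a b, IsNullSTS.der tp a a = 0 → IsNullSTS.der tp b b = 0 → tp a b v = 0 := by
    refine fun a b ha hb => hv _ ⟨IsNullSTS.der_mem_derSpan a b, fun X hX => ?_⟩
    induction hX using Submodule.span_induction with
    | mem _ hx =>
      obtain ⟨p, rfl⟩ := hx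
      exact h.der_mul_der_mul_der h2 h3 ha hb _ _
    | zero => simp
    | add _ _ _ _ hx hy => rw [mul_add, add_mul, hx, hy, add_zero]
    | smul c _ _ hx => rw [mul_smul_comm, smul_mul_assoc, hx, smul_zero]
  have hker : ∀ a b, tp a b v = 0 := fun a b => by
    have ha : a ∈ Submodule.span k {z : T | IsNullSTS.der tp z z = 0} := hspan ▸ Submodule.mem_top
    have hb : b ∈ Submodule.span k {z : T | IsNullSTS.der tp z z = 0} := hspan ▸ Submodule.mem_top
    induction ha, hb using Submodule.span_induction₂ with
    | mem_mem a b ha hb => exact hsand a b ha hb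
    | zero_left => simp
    | zero_right => simp
    | add_left _ _ _ _ _ _ hx hy => simp [hx, hy]
    | add_right _ _ _ _ _ _ hx hy => simp [hx, hy]
    | smul_left _ _ _ _ _ hx => simp [hx]
    | smul_right _ _ _ _ _ hx => simp [hx]
  let K : Submodule k T := ⨅ p : T × T, LinearMap.ker (tp p.1 p.2)
  have hK : ∀ w, w ∈ K ↔ ∀ a b, tp a b w = 0 := fun w => by simp [K, Submodule.mem_iInf]
  rcases hI K (fun a b w hw => by rw [(hK w).mp hw]; exact K.zero_mem) with hbot | htop
  · exact hv0 ((Submodule.mem_bot k).mp (hbot ▸ (hK v).mpr hker))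
  · exact hxyz ((hK z).mp (htop ▸ Submodule.mem_top) x y)
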